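/- Let n ≥ 1 be an integer, let ξ ∈ ℝ^{n+1} have ℚ-linearly independent coordinates, let S ⊆ ℤ^{n+1} satisfy lim_{X→∞} 𝓛_ξ(X;S) = 0, and let (x_i)_{i≥0} be a sequence of minimal points for ξ with respect to S. Then every subsequence (y_i)_{i≥0} of (x_i)_{i≥0} spans ℝ^{n+1} over ℝ; that is, span_ℝ{ y_i : i ∈ ℕ } = ℝ^{n+1}. -/

import Mathlib

open Filter

/-- Euclidean norm of an integer point of `ℤ^{n+1}`. -/
noncomputable def inorm {n : ℕ} (x : Fin (n + 1) → ℤ) : ℝ :=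
  Real.sqrt (∑ k, ((x k : ℝ)) ^ 2)

/-- `L_ξ(x) = max_{1 ≤ k ≤ n} |ξ₀ x_k − ξ_k x₀|` (the term `k = 0` vanishes, so the
maximum over all `k` agrees with the maximum over `1 ≤ k ≤ n` when `n ≥ 1`). -/
noncomputable def Lxi {n : ℕ} (ξ : Fin (n + 1) → ℝ) (x : Fin (n + 1) → ℤ) : ℝ :=
  Finset.univ.sup' Finset.univ_nonempty fun k => |ξ 0 * (x k : ℝ) - ξ k * (x 0 : ℝ)|

/-- `𝓛_ξ(X; S) = min { L_ξ(x) : x ∈ S, 0 < ‖x‖ ≤ X }`, with the convention `min ∅ = ∞`. -/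
noncomputable def calL {n : ℕ} (ξ : Fin (n + 1) → ℝ) (S : Set (Fin (n + 1) → ℤ)) (X : ℝ) :
    ENNReal :=
  sInf { l | ∃ x ∈ S, x ≠ 0 ∧ inorm x ≤ X ∧ l = ENNReal.ofReal (Lxi ξ x) }

/-- `x` is a sequence of minimal points for `ξ` with respect to `S`. -/
def IsMinimalSeq {n : ℕ} (ξ : Fin (n + 1) → ℝ) (S : Set (Fin (n + 1) → ℤ))
    (x : ℕ → Fin (n + 1) → ℤ) : Prop :=
  (∀ i, x i ∈ S ∧ x i ≠ 0) ∧
  (StrictMono fun i => inorm (x i)) ∧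
  (StrictAnti fun i => Lxi ξ (x i)) ∧
  ∀ i, ∀ z ∈ S, z ≠ 0 → inorm z < inorm (x (i + 1)) → Lxi ξ (x i) ≤ Lxi ξ z

/-- The real vector associated with an integer point. -/
def rvec {n : ℕ} (x : Fin (n + 1) → ℤ) : Fin (n + 1) → ℝ := fun k => (x k : ℝ)

/-- `𝒱[i,j] = span_ℝ(x_i, x_{i+1}, …, x_j)`. -/
def Vspan {n : ℕ} (x : ℕ → Fin (n + 1) → ℤ) (i j : ℕ) : Submodule ℝ (Fin (n + 1) → ℝ) :=
  Submodule.span ℝ ((fun m => rvec (x m)) '' Set.Icc i j)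

lemma aux_abs_le_inorm {n : ℕ} (x : Fin (n + 1) → ℤ) (k : Fin (n + 1)) :
    |(x k : ℝ)| ≤ inorm x := by
  unfold inorm
  apply Real.abs_le_sqrt
  exact Finset.single_le_sum (f := fun k => ((x k : ℝ)) ^ 2) (fun i _ => sq_nonneg _)
    (Finset.mem_univ k)

lemma aux_finite {n : ℕ} (X : ℝ) : {x : Fin (n + 1) → ℤ | inorm x ≤ X}.Finite := by
  refine (Set.finite_Icc (fun _ : Fin (n + 1) => -⌈X⌉) (fun _ => ⌈X⌉)).subset ?_
  intro x hx
  have h : ∀ k, |x k| ≤ ⌈X⌉ := by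
    intro k
    have h1 := (aux_abs_le_inorm x k).trans ((show inorm x ≤ X from hx).trans (Int.le_ceil X))
    exact_mod_cast h1
  exact ⟨fun k => (abs_le.mp (h k)).1, fun k => (abs_le.mp (h k)).2⟩

lemma aux_small {n : ℕ} (ξ : Fin (n + 1) → ℝ) (S : Set (Fin (n + 1) → ℤ))
    (hlim : Filter.Tendsto (calL ξ S) Filter.atTop (nhds 0))
    (x : ℕ → Fin (n + 1) → ℤ) (hx : IsMinimalSeq ξ S x) (ε : ℝ) (hε : 0 < ε) :
    ∃ i₀, ∀ i, i₀ ≤ i → Lxi ξ (x i) < ε := by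
  obtain ⟨-, hmono, hanti, hmin⟩ := hx
  have h1 : ∀ᶠ X in atTop, calL ξ S X < ENNReal.ofReal ε :=
    hlim.eventually_lt_const (by simpa using hε)
  obtain ⟨X, hX⟩ := h1.exists
  obtain ⟨l, ⟨z, hzS, hz0, -, rfl⟩, hl⟩ := sInf_lt_iff.mp hX
  have hzε : Lxi ξ z < ε := (ENNReal.ofReal_lt_ofReal_iff hε).mp hl
  have h2 : ∃ i, inorm z < inorm (x (i + 1)) := by
    by_contra! hcon
    have hinj : Function.Injective (fun i => x (i + 1)) := by
      intro i j hij
      have := hmono.injective (congrArg inorm hij : inorm (x (i + 1)) = inorm (x (j + 1)))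
      omega
    exact Set.infinite_range_of_injective hinj
      ((aux_finite (inorm z)).subset (by rintro _ ⟨i, rfl⟩; exact hcon i))
  obtain ⟨i, hi⟩ := h2
  exact ⟨i, fun j hj => ((hanti.antitone hj).trans (hmin i z hzS hz0 hi)).trans_lt hzε⟩

lemma aux_le_L {n : ℕ} (ξ : Fin (n + 1) → ℝ) (x : Fin (n + 1) → ℤ) (k : Fin (n + 1)) :
    |ξ 0 * (x k : ℝ) - ξ k * (x 0 : ℝ)| ≤ Lxi ξ x :=
  Finset.le_sup' (fun k => |ξ 0 * (x k : ℝ) - ξ k * (x 0 : ℝ)|) (Finset.mem_univ k)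

lemma aux_form {n : ℕ} (y : ℕ → Fin (n + 1) → ℤ)
    (h : Submodule.span ℝ (Set.range fun i => rvec (y i)) ≠ ⊤) :
    ∃ a : Fin (n + 1) → ℚ, a ≠ 0 ∧ ∀ i, ∑ k, a k * (y i k : ℚ) = 0 := by
  set V := Submodule.span ℝ (Set.range fun i => rvec (y i)) with hV
  let W : Submodule ℚ (Fin (n + 1) → ℚ) :=
    Submodule.span ℚ (Set.range fun i => fun k => (y i k : ℚ))
  let c : (Fin (n + 1) → ℚ) →ₗ[ℚ] (Fin (n + 1) → ℝ) :=
    { toFun := fun v k => (v k : ℝ)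
      map_add' := by intro u v; ext k; simp
      map_smul' := by intro r v; ext k; simp [Rat.smul_def] }
  have hWc : W ≤ (V.restrictScalars ℚ).comap c := by
    refine Submodule.span_le.mpr ?_
    rintro _ ⟨i, rfl⟩
    have h1 : rvec (y i) ∈ V := Submodule.subset_span ⟨i, rfl⟩
    have h2 : c (fun k => (y i k : ℚ)) = rvec (y i) := by
      ext k; simp [c, rvec]
    change c (fun k => (y i k : ℚ)) ∈ V
    rw [h2]; exact h1
  have hW : W < ⊤ := by
    refine lt_top_iff_ne_top.mpr fun hWt => h ?_
    rw [eq_top_iff, ← (Pi.basisFun ℝ (Fin (n + 1))).span_eq]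
    refine Submodule.span_le.mpr ?_
    rintro _ ⟨k, rfl⟩
    have h1 : (Pi.single k 1 : Fin (n + 1) → ℚ) ∈ W := by rw [hWt]; trivial
    have h2 : c (Pi.single k 1) ∈ V := hWc h1
    have h3 : c (Pi.single k 1) = Pi.basisFun ℝ (Fin (n + 1)) k := by
      ext j; by_cases hj : j = k <;> simp [c, Pi.single_apply, hj]
    rw [← h3]; exact h2
  obtain ⟨f, hf0, hf⟩ := Submodule.exists_le_ker_of_lt_top W hW
  have hfe : ∀ v, f v = ∑ k, f (Pi.single k 1) * v k := by
    intro v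
    rw [LinearMap.pi_apply_eq_sum_univ f v]
    refine Finset.sum_congr rfl fun k _ => ?_
    rw [smul_eq_mul, mul_comm]
    congr 2
    ext j; simp [Pi.single_apply, eq_comm]
  refine ⟨fun k => f (Pi.single k 1), ?_, ?_⟩
  · intro h0
    apply hf0
    ext v
    simpa using congrFun h0 v
  · intro i
    rw [← hfe (fun k => (y i k : ℚ))]
    exact hf (Submodule.subset_span ⟨i, rfl⟩)

/-- Every subsequence of a sequence of minimal points spans `ℝ^{n+1}`. -/
theorem subsequence_spans (n : ℕ) (hn : 1 ≤ n) (ξ : Fin (n + 1) → ℝ)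
    (hξ : LinearIndependent ℚ ξ) (S : Set (Fin (n + 1) → ℤ))
    (hlim : Filter.Tendsto (calL ξ S) Filter.atTop (nhds 0))
    (x : ℕ → Fin (n + 1) → ℤ) (hx : IsMinimalSeq ξ S x) :
    ∀ g : ℕ → ℕ, StrictMono g →
      Submodule.span ℝ (Set.range fun i => rvec (x (g i))) = ⊤ := by
  intro g hg
  by_contra hne
  obtain ⟨a, ha0, ha⟩ := aux_form (fun i => x (g i)) hne
  have hξ0 : 0 < |ξ 0| := abs_pos.mpr (hξ.ne_zero 0)
  have haξ : ∑ k, (a k : ℝ) * ξ k ≠ 0 := by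
    intro h0
    apply ha0
    ext k
    exact Fintype.linearIndependent_iff.mp hξ a (by simpa [Rat.smul_def] using h0) k
  set B := |∑ k, (a k : ℝ) * ξ k| with hB
  have hBpos : 0 < B := abs_pos.mpr haξ
  set A := ∑ k, |(a k : ℝ)| with hA
  have hA0 : 0 ≤ A := Finset.sum_nonneg fun _ _ => abs_nonneg _
  obtain ⟨i, hi⟩ := aux_small ξ S hlim x hx (min |ξ 0| (B / (A + 1)))
    (lt_min hξ0 (by positivity))
  have hL := hi (g i) hg.le_apply
  have hL1 := hL.trans_le (min_le_left _ _)
  have hL2 := hL.trans_le (min_le_right _ _)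
  have hyi := ha i
  have hy0 := (hx.1 (g i)).2
  generalize x (g i) = y at *
  have hLn : 0 ≤ Lxi ξ y := (abs_nonneg _).trans (aux_le_L ξ y 0)
  by_cases h0 : y 0 = 0
  · obtain ⟨k, hk⟩ := Function.ne_iff.mp hy0
    have h1 := aux_le_L ξ y k
    have h2 : (1 : ℝ) ≤ |(y k : ℝ)| := by exact_mod_cast Int.one_le_abs hk
    rw [h0, Int.cast_zero, mul_zero, sub_zero, abs_mul] at h1
    nlinarith
  · have h2 : (1 : ℝ) ≤ |(y 0 : ℝ)| := by exact_mod_cast Int.one_le_abs h0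
    have hyR : ∑ k, (a k : ℝ) * (y k : ℝ) = 0 := by exact_mod_cast hyi
    have h3 : ∑ k, (a k : ℝ) * (ξ 0 * (y k : ℝ) - ξ k * (y 0 : ℝ))
        = -((∑ k, (a k : ℝ) * ξ k) * (y 0 : ℝ)) := by
      have : ∑ k, (a k : ℝ) * (ξ 0 * (y k : ℝ) - ξ k * (y 0 : ℝ))
        = ξ 0 * ∑ k, (a k : ℝ) * (y k : ℝ) - (∑ k, (a k : ℝ) * ξ k) * (y 0 : ℝ) := by
        rw [Finset.mul_sum, Finset.sum_mul, ← Finset.sum_sub_distrib]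
        exact Finset.sum_congr rfl fun k _ => by ring
      rw [this, hyR]; ring
    have h4 : B * |(y 0 : ℝ)| ≤ A * Lxi ξ y := by
      rw [hB, ← abs_mul, ← abs_neg, ← h3, hA, Finset.sum_mul]
      refine (Finset.abs_sum_le_sum_abs _ _).trans (Finset.sum_le_sum fun k _ => ?_)
      rw [abs_mul]
      exact mul_le_mul_of_nonneg_left (aux_le_L ξ y k) (abs_nonneg _)
    rw [lt_div_iff₀ (by positivity)] at hL2
    nlinarith
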